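/- Let (Ω, μ) be a finite measure space, p ∈ (0,2), and ε > 0. Then the functional G_ε : L²(Ω, μ) → ℝ defined by G_ε(w) := ∫_Ω ψ_ε(w(x)²) dμ(x) is Fréchet differentiable, and its derivative at w is the bounded linear functional h ↦ ∫_Ω 2 w(x) ψ_ε'(w(x)²) h(x) dμ(x). -/

import Mathlib

open MeasureTheory

/-- The smoothed `p/2`-power function `ψ_ε`. -/
noncomputable def psi (p ε t : ℝ) : ℝ :=
  if t < ε ^ 2 then (p / 2) * t * ε ^ (p - 2) + (1 - p / 2) * ε ^ p
  else t ^ (p / 2)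

/-- Its derivative `ψ_ε'` (for `ε > 0`). -/
noncomputable def psiD (p ε t : ℝ) : ℝ :=
  if t = 0 then (p / 2) * ε ^ (p - 2)
  else (p / 2) * min (ε ^ (p - 2)) (t ^ ((p - 2) / 2))

lemma rpow_le_tangent {q a b : ℝ} (hq0 : 0 ≤ q) (hq1 : q ≤ 1) (ha : 0 < a) (hb : 0 ≤ b) :
    b ^ q ≤ a ^ q + q * a ^ (q - 1) * (b - a) := by
  have h := rpow_one_add_le_one_add_mul_self (s := (b - a) / a) (p := q)
    (by rw [le_div_iff₀ ha]; linarith) hq0 hq1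
  have h1 : 1 + (b - a) / a = b / a := by field_simp; ring
  rw [h1, Real.div_rpow hb ha.le, div_le_iff₀ (Real.rpow_pos_of_pos ha q)] at h
  calc b ^ q ≤ _ := h
    _ = _ := by rw [Real.rpow_sub_one ha.ne']; field_simp

lemma rpow_eq_sq_rpow {ε : ℝ} (hε : 0 < ε) (x : ℝ) : ε ^ x = (ε ^ 2) ^ (x / 2) := by
  rw [← Real.rpow_natCast, ← Real.rpow_mul hε.le]
  congr 1
  push_cast
  ring

lemma psi_eq {p ε : ℝ} (hε : 0 < ε) (t : ℝ) :
    psi p ε t = if t < ε ^ 2 then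
      (ε ^ 2) ^ (p / 2) + p / 2 * (ε ^ 2) ^ (p / 2 - 1) * (t - ε ^ 2) else t ^ (p / 2) := by
  have he : 0 < ε ^ 2 := by positivity
  rw [psi, rpow_eq_sq_rpow hε p, rpow_eq_sq_rpow hε (p - 2),
    show (p - 2) / 2 = p / 2 - 1 by ring, Real.rpow_sub_one he.ne']
  split_ifs
  · field_simp
    ring
  · rfl

lemma psiD_eq {p ε : ℝ} (hp : p ≤ 2) (hε : 0 < ε) {t : ℝ} (ht : 0 ≤ t) :
    psiD p ε t = p / 2 * (max (ε ^ 2) t) ^ (p / 2 - 1) := by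
  have he : 0 < ε ^ 2 := by positivity
  rw [psiD, rpow_eq_sq_rpow hε (p - 2), show (p - 2) / 2 = p / 2 - 1 by ring]
  split_ifs with h
  · rw [h, max_eq_left he.le]
  · have ht' : 0 < t := lt_of_le_of_ne ht (Ne.symm h)
    rcases le_total (ε ^ 2) t with h2 | h2
    · rw [max_eq_right h2,
        min_eq_right (Real.rpow_le_rpow_of_nonpos he h2 (by linarith))]
    · rw [max_eq_left h2,
        min_eq_left (Real.rpow_le_rpow_of_nonpos ht' h2 (by linarith))]

lemma psi_le_tangent {p ε : ℝ} (hp : p ∈ Set.Ioo (0 : ℝ) 2) (hε : 0 < ε) {a b : ℝ}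
    (ha : 0 ≤ a) (hb : 0 ≤ b) : psi p ε b ≤ psi p ε a + psiD p ε a * (b - a) := by
  obtain ⟨hp0, hp2⟩ := hp
  have he : 0 < ε ^ 2 := by positivity
  rw [psi_eq hε, psi_eq hε, psiD_eq hp2.le hε ha]
  split_ifs with h1 h2 h2
  · rw [max_eq_left h2.le]
    linarith
  · rw [not_lt] at h2
    rw [max_eq_right h2]
    have h3 := rpow_le_tangent (q := p / 2) (by linarith) (by linarith) (he.trans_le h2) he.le
    have h4 : p / 2 * a ^ (p / 2 - 1) ≤ p / 2 * (ε ^ 2) ^ (p / 2 - 1) :=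
      mul_le_mul_of_nonneg_left (Real.rpow_le_rpow_of_nonpos he h2 (by linarith)) (by linarith)
    nlinarith [mul_nonneg (sub_nonneg.2 h4) (sub_nonneg.2 h1.le)]
  · rw [max_eq_left h2.le]
    have h3 := rpow_le_tangent (q := p / 2) (by linarith) (by linarith) he hb
    linarith
  · rw [not_lt] at h2
    rw [max_eq_right h2]
    exact rpow_le_tangent (by linarith) (by linarith) (he.trans_le h2) hb

lemma psiD_nonneg {p ε : ℝ} (hp : p ∈ Set.Ioo (0 : ℝ) 2) (hε : 0 < ε) {t : ℝ} (ht : 0 ≤ t) :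
    0 ≤ psiD p ε t := by
  rw [psiD_eq hp.2.le hε ht]
  have := hp.1
  positivity

lemma psiD_anti {p ε : ℝ} (hp : p ∈ Set.Ioo (0 : ℝ) 2) (hε : 0 < ε) {s t : ℝ}
    (hs : 0 ≤ s) (hst : s ≤ t) : psiD p ε t ≤ psiD p ε s := by
  have he : 0 < ε ^ 2 := by positivity
  have hp0 := hp.1
  rw [psiD_eq hp.2.le hε hs, psiD_eq hp.2.le hε (hs.trans hst)]
  exact mul_le_mul_of_nonneg_left (Real.rpow_le_rpow_of_nonpos (lt_max_of_lt_left he)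
    (max_le_max_left _ hst) (by linarith [hp.2])) (by linarith)

lemma mul_psiD_mono {p ε : ℝ} (hp : p ∈ Set.Ioo (0 : ℝ) 2) (hε : 0 < ε) {s t : ℝ}
    (hs : 0 ≤ s) (hst : s ≤ t) : s * psiD p ε s ≤ t * psiD p ε t := by
  have he : 0 < ε ^ 2 := by positivity
  have hp0 := hp.1
  rw [psiD_eq hp.2.le hε hs, psiD_eq hp.2.le hε (hs.trans hst)]
  have hMs : 0 < max (ε ^ 2) s := lt_max_of_lt_left he
  have hMt : 0 < max (ε ^ 2) t := lt_max_of_lt_left he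
  rw [Real.rpow_sub_one hMs.ne', Real.rpow_sub_one hMt.ne']
  have h1 : s / max (ε ^ 2) s ≤ t / max (ε ^ 2) t := by
    rw [div_le_div_iff₀ hMs hMt, mul_max_of_nonneg _ _ hs, mul_max_of_nonneg _ _ (hs.trans hst)]
    exact max_le_max (mul_le_mul_of_nonneg_right hst he.le) (mul_comm s t).le
  have h2 : (max (ε ^ 2) s) ^ (p / 2) ≤ (max (ε ^ 2) t) ^ (p / 2) :=
    Real.rpow_le_rpow hMs.le (max_le_max_left _ hst) (by linarith)
  have h3 := mul_le_mul h1 h2 (by positivity) (div_nonneg (hs.trans hst) hMt.le)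
  calc _ = p / 2 * (s / max (ε ^ 2) s * (max (ε ^ 2) s) ^ (p / 2)) := by ring
    _ ≤ p / 2 * (t / max (ε ^ 2) t * (max (ε ^ 2) t) ^ (p / 2)) :=
      mul_le_mul_of_nonneg_left h3 (by linarith)
    _ = _ := by ring

lemma psiD_le_zero {p ε : ℝ} (hp : p ∈ Set.Ioo (0 : ℝ) 2) (hε : 0 < ε) {t : ℝ} (ht : 0 ≤ t) :
    psiD p ε t ≤ psiD p ε 0 := psiD_anti hp hε le_rfl ht

lemma abs_mul_psiD_sub_le {p ε : ℝ} (hp : p ∈ Set.Ioo (0 : ℝ) 2) (hε : 0 < ε) (s v : ℝ) :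
    |s * psiD p ε (s ^ 2) - v * psiD p ε (v ^ 2)| ≤ 3 * psiD p ε 0 * |s - v| := by
  wlog h : |s| ≤ |v| generalizing s v
  · rw [abs_sub_comm, abs_sub_comm s]
    exact this v s (le_of_not_ge h)
  have hsq : s ^ 2 ≤ v ^ 2 := sq_le_sq.2 h
  have h1 := psiD_anti hp hε (sq_nonneg s) hsq
  have h2 := mul_psiD_mono hp hε (sq_nonneg s) hsq
  have h3 := psiD_le_zero hp hε (sq_nonneg s)
  have h4 := psiD_le_zero hp hε (sq_nonneg v)
  have h5 := psiD_nonneg hp hε (sq_nonneg v)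
  set a := psiD p ε (s ^ 2)
  set b := psiD p ε (v ^ 2)
  set c := psiD p ε 0
  have hsv : |v| - |s| ≤ |s - v| := by rw [abs_sub_comm]; exact abs_sub_abs_le_abs_sub v s
  have key : |s| * (a - b) ≤ 2 * c * |s - v| := by
    rw [← sq_abs s, ← sq_abs v] at h2
    have h0 := abs_nonneg s
    suffices |s| * (a - b) ≤ 2 * c * (|v| - |s|) by
      nlinarith
    rcases h0.eq_or_lt with h0 | h0
    · rw [← h0]
      nlinarith [abs_nonneg v]
    · generalize |s| = x at *
      generalize |v| = y at *
      have hy : 0 < y := h0.trans_le h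
      have e1 : y ^ 2 * (a - b) ≤ a * ((y - x) * (y + x)) := by nlinarith
      have e2 : x * y ^ 2 * (a - b) ≤ (2 * c * (y - x)) * y ^ 2 := by
        calc x * y ^ 2 * (a - b) = x * (y ^ 2 * (a - b)) := by ring
          _ ≤ x * (a * ((y - x) * (y + x))) := by gcongr
          _ ≤ y * (c * ((y - x) * (y + y))) := by
            have : 0 ≤ y - x := by linarith
            have : 0 ≤ a := by linarith
            have : 0 ≤ c := by linarith
            gcongr
          _ = _ := by ring
      refine le_of_mul_le_mul_right (a := y ^ 2) ?_ (by positivity)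
      linarith
  calc |s * a - v * b| = |s * (a - b) + (s - v) * b| := by ring_nf
    _ ≤ |s| * (a - b) + |s - v| * b := by
      refine (abs_add_le _ _).trans ?_
      rw [abs_mul, abs_mul, abs_of_nonneg (sub_nonneg.2 h1), abs_of_nonneg h5]
    _ ≤ 3 * c * |s - v| := by nlinarith [abs_nonneg (s - v)]

lemma abs_psi_sq_sub_le {p ε : ℝ} (hp : p ∈ Set.Ioo (0 : ℝ) 2) (hε : 0 < ε) (s v : ℝ) :
    |psi p ε (v ^ 2) - psi p ε (s ^ 2) - 2 * s * psiD p ε (s ^ 2) * (v - s)|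
      ≤ 7 * psiD p ε 0 * (v - s) ^ 2 := by
  have h1 := psi_le_tangent hp hε (sq_nonneg s) (sq_nonneg v)
  have h2 := psi_le_tangent hp hε (sq_nonneg v) (sq_nonneg s)
  have h3 := psiD_le_zero hp hε (sq_nonneg s)
  have h4 := psiD_le_zero hp hε (sq_nonneg v)
  have h5 := psiD_nonneg hp hε (sq_nonneg v)
  have h6 := abs_mul_psiD_sub_le hp hε s v
  have h7 : |(s * psiD p ε (s ^ 2) - v * psiD p ε (v ^ 2)) * (v - s)|
      ≤ 3 * psiD p ε 0 * (v - s) ^ 2 := by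
    rw [abs_mul, ← sq_abs (v - s), abs_sub_comm v s]
    nlinarith [abs_nonneg (s - v)]
  have h8 := abs_le.1 h7
  have h9 := mul_le_mul_of_nonneg_right h3 (sq_nonneg (v - s))
  have h10 := mul_le_mul_of_nonneg_right h4 (sq_nonneg (v - s))
  have h11 := mul_nonneg (h5.trans h4) (sq_nonneg (v - s))
  rw [abs_le]
  constructor <;> nlinarith

lemma psi_nonneg {p ε : ℝ} (hp : p ∈ Set.Ioo (0 : ℝ) 2) (hε : 0 < ε) {t : ℝ} (ht : 0 ≤ t) :
    0 ≤ psi p ε t := by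
  have h0 := hp.1
  have h1 : 0 ≤ 1 - p / 2 := by linarith [hp.2]
  rw [psi]
  split_ifs <;> positivity

lemma measurable_psi (p ε : ℝ) : Measurable (psi p ε) := by
  unfold psi
  exact Measurable.ite measurableSet_Iio (by fun_prop) (by fun_prop)

lemma measurable_psiD (p ε : ℝ) : Measurable (psiD p ε) := by
  unfold psiD
  exact Measurable.ite (measurableSet_singleton 0) (by fun_prop) (by fun_prop)

lemma integrable_psi_sq {Ω : Type*} [MeasurableSpace Ω] {μ : Measure Ω} [IsFiniteMeasure μ]
    {p ε : ℝ} (hp : p ∈ Set.Ioo (0 : ℝ) 2) (hε : 0 < ε) {u : Ω → ℝ} (hu : MemLp u 2 μ) :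
    Integrable (fun x => psi p ε (u x ^ 2)) μ := by
  have hb : Integrable (fun x => psi p ε 0 + psiD p ε 0 * u x ^ 2) μ :=
    (integrable_const _).add (hu.integrable_sq.const_mul _)
  refine hb.mono' ((measurable_psi p ε).comp_aemeasurable
    (hu.aemeasurable.pow_const 2)).aestronglyMeasurable (.of_forall fun x => ?_)
  rw [Real.norm_of_nonneg (psi_nonneg hp hε (sq_nonneg _))]
  simpa using psi_le_tangent hp hε le_rfl (sq_nonneg (u x))

lemma memLp_mul_psiD_sq {Ω : Type*} [MeasurableSpace Ω] {μ : Measure Ω}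
    {p ε : ℝ} (hp : p ∈ Set.Ioo (0 : ℝ) 2) (hε : 0 < ε) {u : Ω → ℝ} (hu : MemLp u 2 μ) :
    MemLp (fun x => 2 * u x * psiD p ε (u x ^ 2)) 2 μ := by
  refine hu.of_le_mul (c := 2 * psiD p ε 0) (((hu.aemeasurable.const_mul 2).mul
    ((measurable_psiD p ε).comp_aemeasurable
    (hu.aemeasurable.pow_const 2))).aestronglyMeasurable) (.of_forall fun x => ?_)
  have h1 := psiD_le_zero hp hε (sq_nonneg (u x))
  rw [norm_mul, norm_mul, Real.norm_of_nonneg (psiD_nonneg hp hε (sq_nonneg (u x))),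
    Real.norm_two]
  nlinarith [norm_nonneg (u x)]

/-- On a finite measure space, for `p ∈ (0,2)` and `ε > 0`, the functional
`G_ε(w) = ∫ ψ_ε(w²) dμ` is Fréchet differentiable on `L²(Ω,μ)` with derivative at `w`
given by the bounded linear functional `h ↦ ∫ 2 w ψ_ε'(w²) h dμ`. -/
theorem G_eps_frechet_differentiable {Ω : Type*} [MeasurableSpace Ω] (μ : Measure Ω)
    [IsFiniteMeasure μ] (p ε : ℝ) (hp : p ∈ Set.Ioo (0 : ℝ) 2) (hε : 0 < ε)
    (w : Lp ℝ 2 μ) :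
    ∃ D : Lp ℝ 2 μ →L[ℝ] ℝ,
      (∀ h : Lp ℝ 2 μ, D h = ∫ x, 2 * w x * psiD p ε ((w x) ^ 2) * h x ∂μ) ∧
      HasFDerivAt (fun u : Lp ℝ 2 μ => ∫ x, psi p ε ((u x) ^ 2) ∂μ) D w := by
  have hg := memLp_mul_psiD_sq hp hε (Lp.memLp w)
  have hD (h : Lp ℝ 2 μ) : innerSL ℝ (hg.toLp _) h
      = ∫ x, 2 * w x * psiD p ε ((w x) ^ 2) * h x ∂μ := by
    rw [innerSL_apply_apply, L2.inner_def]
    refine integral_congr_ae ?_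
    filter_upwards [hg.coeFn_toLp] with x hx
    simp [hx, mul_comm]
  refine ⟨innerSL ℝ (hg.toLp _), hD, ?_⟩
  refine .of_isLittleO <| Asymptotics.IsBigO.trans_isLittleO (g := fun u => ‖u - w‖ ^ 2)
    (.of_bound (7 * psiD p ε 0) (.of_forall fun u => ?_)) ?_
  · have hdiff : ⇑(u - w) =ᵐ[μ] fun x => u x - w x := Lp.coeFn_sub u w
    have hsq : ‖u - w‖ ^ 2 = ∫ x, (u x - w x) ^ 2 ∂μ := by
      rw [← real_inner_self_eq_norm_sq, L2.inner_def]
      refine integral_congr_ae ?_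
      filter_upwards [hdiff] with x hx
      rw [hx]
      simp [sq]
    have hlin : innerSL ℝ (hg.toLp _) (u - w)
        = ∫ x, 2 * w x * psiD p ε ((w x) ^ 2) * (u x - w x) ∂μ := by
      rw [hD]
      refine integral_congr_ae ?_
      filter_upwards [hdiff] with x hx
      rw [hx]
    have huw : MemLp (fun x => u x - w x) 2 μ := (Lp.memLp u).sub (Lp.memLp w)
    have hiu := integrable_psi_sq hp hε (Lp.memLp u)
    have hiw := integrable_psi_sq hp hε (Lp.memLp w)
    have hig : Integrable (fun x => 2 * w x * psiD p ε ((w x) ^ 2) * (u x - w x)) μ :=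
      hg.integrable_mul huw
    rw [hlin, ← integral_sub hiu hiw, ← integral_sub (by exact hiu.sub hiw) hig,
      Real.norm_of_nonneg (sq_nonneg ‖u - w‖), hsq, ← integral_const_mul]
    exact norm_integral_le_of_norm_le (huw.integrable_sq.const_mul _)
      (.of_forall fun x => abs_psi_sq_sub_le hp hε (w x) (u x))
  · exact Asymptotics.isLittleO_pow_sub_sub w one_lt_two
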